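/- Let p be a prime number, let G be a finite group, let N be a normal subgroup of G whose order is coprime to p, and let M be a finite abelian p-group equipped with an action of G by group automorphisms. If the subgroup M^N of N-fixed points of M is trivial, then the first group cohomology H^1(G, M) vanishes. -/

import Mathlib

/-- Lemma 4.1.1 (inflation–restriction argument): if `G` is a finite group,
`N ⊴ G` has order coprime to the prime `p`, and `M` is a finite abelian `p`-group
with a `G`-action whose `N`-fixed points are trivial, then `H¹(G, M) = 0`, i.e.
every 1-cocycle `f : G → M` is a coboundary. -/
theorem stmt2
    (p : ℕ) (hp : p.Prime)
    (G : Type*) [Group G] [Finite G] (N : Subgroup G) [N.Normal]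
    (hN : Nat.Coprime (Nat.card N) p)
    (M : Type*) [AddCommGroup M] [Finite M] [DistribMulAction G M]
    (hM : ∃ n : ℕ, Nat.card M = p ^ n)
    (hfix : ∀ m : M, (∀ g ∈ N, g • m = m) → m = 0) :
    ∀ f : G → M, (∀ g h : G, f (g * h) = f g + g • f h) →
      ∃ m : M, ∀ g : G, f g = g • m - m := by
  classical
  intro f hf
  obtain ⟨k, hk⟩ := hM
  have hcop : (Nat.card M).Coprime (Nat.card N) := by
    rw [hk]; exact (hN.pow_right k).symm
  have hbij : Function.Bijective (fun x : M => Nat.card N • x) :=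
    (nsmulCoprime hcop).bijective
  have : Fintype N := Fintype.ofFinite N
  set S : M := ∑ n : N, f n with hS
  have key : ∀ n : N, S = Nat.card N • f n + (n : G) • S := by
    intro n
    have h1 : S = ∑ x : N, f ((n * x : N) : G) :=
      (Equiv.sum_comp (Equiv.mulLeft n) (fun x : N => f x)).symm
    refine h1.trans ?_
    simp only [Subgroup.coe_mul, hf, Finset.sum_add_distrib, ← Finset.smul_sum]
    simp [Nat.card_eq_fintype_card, hS, Finset.sum_const]
  obtain ⟨T, hT⟩ := hbij.2 (-S)
  simp only at hT
  have hn : ∀ n ∈ N, f n = n • T - T := by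
    intro n hn
    apply hbij.1
    have := key ⟨n, hn⟩
    simp only at this ⊢
    rw [nsmul_sub, smul_comm (Nat.card N) n T, hT, smul_neg]
    rw [eq_comm, ← eq_sub_iff_add_eq] at this
    rw [this]; abel
  refine ⟨T, fun g => ?_⟩
  rw [← sub_eq_zero]
  apply hfix
  intro n hnN
  have hc : g⁻¹ * n * g ∈ N := by
    simpa using Subgroup.Normal.conj_mem ‹N.Normal› n hnN g⁻¹
  have e1 := hf n g
  have e2 := hf g (g⁻¹ * n * g)
  rw [hn _ hc, smul_sub, smul_smul] at e2
  have e3 : g * (g⁻¹ * n * g) = n * g := by group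
  rw [e3, e1, hn n hnN, mul_smul] at e2
  rw [smul_sub, smul_sub]
  have e4 : n • f g = f g + (n • g • T - g • T) - (n • T - T) := by
    rw [← e2]; abel
  rw [e4]; abel
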